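/- arXiv:1005.0128 — 2 statements merged into one kernel-verified Lean document; each statement's English description precedes it below -/
import Mathlib

section
/- Let X be a finite list of nonzero vectors spanning a real vector space g* of dimension s. The dimension of the space D(X) (solutions of the cocircuit differential equations) equals the number of bases of g* that can be extracted from X. -/
/-!
STATEMENT 1: For a finite list X of nonzero vectors spanning g* (here g* = ℝⁿ),
the dimension of the space D(X) of polynomial solutions of the cocircuit
differential equations equals the number of bases of g* extractable from X.
-/

noncomputable section

open scoped BigOperators

/-- Directional derivative of polynomials along the vector `a`. -/
def pdirD {n : ℕ} (a : Fin n → ℝ) :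
    Module.End ℝ (MvPolynomial (Fin n) ℝ) :=
  ∑ i, a i • (MvPolynomial.pderiv i).toLinearMap

/-- The product ∂_Y of the directional derivatives along the members of the
sublist of X indexed by `S`. -/
def piterD {n m : ℕ} (X : Fin m → Fin n → ℝ) (S : Finset (Fin m)) :
    Module.End ℝ (MvPolynomial (Fin n) ℝ) :=
  (S.toList.map fun i => pdirD (X i)).prod

/-- A subspace is rational (w.r.t. X) if it is spanned by the elements of X
lying in it. -/
def RationalSub {n m : ℕ} (X : Fin m → Fin n → ℝ)
    (W : Submodule ℝ (Fin n → ℝ)) : Prop :=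
  W = Submodule.span ℝ (Set.range X ∩ ↑W)

open Classical in
/-- `S` indexes a cocircuit of `X`: the sublist of elements of `X` not lying in
some rational hyperplane `H`. -/
def IsCocircuit {n m : ℕ} (X : Fin m → Fin n → ℝ) (S : Finset (Fin m)) : Prop :=
  ∃ H : Submodule ℝ (Fin n → ℝ), RationalSub X H ∧
    Module.finrank ℝ H + 1 = n ∧ S = Finset.univ.filter (fun i => X i ∉ H)

/-- The space D(X) of polynomial solutions of the cocircuit equations. -/
def Dspace {n m : ℕ} (X : Fin m → Fin n → ℝ) :
    Submodule ℝ (MvPolynomial (Fin n) ℝ) :=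
  ⨅ S ∈ {S : Finset (Fin m) | IsCocircuit X S}, LinearMap.ker (piterD X S)

section helpers

lemma pdirD_apply {n : ℕ} (a : Fin n → ℝ) (f : MvPolynomial (Fin n) ℝ) :
    pdirD a f = ∑ i, a i • MvPolynomial.pderiv i f := by
  simp [pdirD, LinearMap.sum_apply]

lemma pderiv_comm' {n : ℕ} (i j : Fin n) (f : MvPolynomial (Fin n) ℝ) :
    MvPolynomial.pderiv i (MvPolynomial.pderiv j f)
      = MvPolynomial.pderiv j (MvPolynomial.pderiv i f) := by
  ext d
  simp only [MvPolynomial.coeff_pderiv]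
  by_cases h : i = j
  · subst h; rfl
  · have h' : j ≠ i := fun e => h e.symm
    simp [add_right_comm, h, h']
    ring

lemma pdirD_comm {n : ℕ} (a b : Fin n → ℝ) : Commute (pdirD a) (pdirD b) := by
  refine LinearMap.ext fun f => ?_
  simp only [Module.End.mul_apply, pdirD_apply, map_sum, map_smul, Finset.smul_sum]
  rw [Finset.sum_comm]
  refine Finset.sum_congr rfl fun i _ => Finset.sum_congr rfl fun j _ => ?_
  rw [pderiv_comm', smul_comm]

lemma piterD_empty {n m : ℕ} (X : Fin m → Fin n → ℝ) : piterD X ∅ = 1 := by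
  simp [piterD]

lemma piterD_insert {n m : ℕ} (X : Fin m → Fin n → ℝ) (z : Fin m) (S : Finset (Fin m))
    (hz : z ∉ S) : piterD X (insert z S) = pdirD (X z) * piterD X S := by
  have hp := (Finset.toList_insert hz).map (fun i => pdirD (X i))
  have := hp.prod_eq' (by
    rw [List.pairwise_map]
    exact List.pairwise_of_forall fun i j => pdirD_comm _ _)
  simpa [piterD] using this

lemma pdirD_piterD {n m : ℕ} (X : Fin m → Fin n → ℝ) (a : Fin n → ℝ) (S : Finset (Fin m)) :
    Commute (pdirD a) (piterD X S) := by
  classical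
  induction S using Finset.induction_on with
  | empty => rw [piterD_empty]; exact Commute.one_right _
  | insert z S hz ih => rw [piterD_insert X z S hz]; exact (pdirD_comm _ _).mul_right ih

lemma pdirD_add {n : ℕ} (a b : Fin n → ℝ) : pdirD (a + b) = pdirD a + pdirD b := by
  simp [pdirD, add_smul, Finset.sum_add_distrib]

lemma pdirD_smul {n : ℕ} (r : ℝ) (a : Fin n → ℝ) : pdirD (r • a) = r • pdirD a := by
  simp [pdirD, mul_smul, Finset.smul_sum]

lemma piterD_mono {n m : ℕ} (X : Fin m → Fin n → ℝ) {S T : Finset (Fin m)} (h : S ⊆ T)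
    (f : MvPolynomial (Fin n) ℝ) (hf : piterD X S f = 0) : piterD X T f = 0 := by
  classical
  have key : ∀ U : Finset (Fin m), piterD X (S ∪ U) f = 0 := by
    intro U
    induction U using Finset.induction_on with
    | empty => simpa using hf
    | insert z U hz ih =>
      rw [Finset.union_insert]
      by_cases hzz : z ∈ S ∪ U
      · rwa [Finset.insert_eq_of_mem hzz]
      · rw [piterD_insert X z _ hzz, Module.End.mul_apply, ih, map_zero]
  have := key T
  rwa [Finset.union_eq_right.2 h] at this

lemma const_of_pdirD {n : ℕ} (f : MvPolynomial (Fin n) ℝ) (h : ∀ a, pdirD a f = 0) :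
    f = MvPolynomial.C (MvPolynomial.coeff 0 f) := by
  have h1 : ∀ i, MvPolynomial.pderiv i f = 0 := by
    intro i
    have := h (Pi.single i 1)
    rw [pdirD_apply, Finset.sum_eq_single i] at this
    · simpa using this
    · intro j _ hj; simp [hj]
    · simp
  ext d
  rw [MvPolynomial.coeff_C]
  split_ifs with hd
  · rw [hd]
  · have : ∃ i, d i ≠ 0 := by
      by_contra hc
      push Not at hc
      exact hd (by ext i; simp [hc i])
    obtain ⟨i, hi⟩ := this
    have hd' : d - Finsupp.single i 1 + Finsupp.single i 1 = d := by
      apply tsub_add_cancel_of_le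
      rw [Finsupp.single_le_iff]; omega
    have h2 := congrArg (MvPolynomial.coeff (d - Finsupp.single i 1)) (h1 i)
    rw [MvPolynomial.coeff_pderiv, hd', MvPolynomial.coeff_zero] at h2
    rcases mul_eq_zero.1 h2 with h3 | h3
    · exact h3
    · exfalso
      have : (0:ℝ) < (((d - Finsupp.single i 1 : Fin n →₀ ℕ) i : ℕ) : ℝ) + 1 := by positivity
      exact this.ne' h3

open Classical in
/-- Relative version of the space: killed by `W`, and by all cocircuit type operators. -/
def DD {n m : ℕ} (X : Fin m → Fin n → ℝ) (S : Finset (Fin m))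
    (W : Submodule ℝ (Fin n → ℝ)) : Submodule ℝ (MvPolynomial (Fin n) ℝ) where
  carrier := {f | (∀ w ∈ W, pdirD w f = 0) ∧
    ∀ H : Submodule ℝ (Fin n → ℝ), W ≤ H → H ≠ ⊤ →
      piterD X (S.filter (fun i => X i ∉ H)) f = 0}
  zero_mem' := ⟨fun _ _ => map_zero _, fun _ _ _ => map_zero _⟩
  add_mem' := fun {f g} hf hg => ⟨fun w hw => by rw [map_add, hf.1 w hw, hg.1 w hw, add_zero],
    fun H h1 h2 => by rw [map_add, hf.2 H h1 h2, hg.2 H h1 h2, add_zero]⟩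
  smul_mem' := fun r f hf => ⟨fun w hw => by rw [map_smul, hf.1 w hw, smul_zero],
    fun H h1 h2 => by rw [map_smul, hf.2 H h1 h2, smul_zero]⟩

/-- Relative bases. -/
def BB {n m : ℕ} (X : Fin m → Fin n → ℝ) (S : Finset (Fin m))
    (W : Submodule ℝ (Fin n → ℝ)) : Set (Finset (Fin m)) :=
  {B | B ⊆ S ∧ W ⊔ Submodule.span ℝ (X '' B) = ⊤ ∧ B.card + Module.finrank ℝ W = n}

lemma BB_step {n m : ℕ} (X : Fin m → Fin n → ℝ) (S : Finset (Fin m)) (z : Fin m) (hz : z ∉ S)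
    (W : Submodule ℝ (Fin n → ℝ)) (hW : X z ∉ W) :
    (BB X S W).ncard + (BB X S (W ⊔ Submodule.span ℝ {X z})).ncard
      ≤ (BB X (insert z S) W).ncard := by
  have hinj : Set.InjOn (fun B : Finset (Fin m) => insert z B)
      (BB X S (W ⊔ Submodule.span ℝ {X z})) := by
    intro B hB C hC h
    have hB' : z ∉ B := fun h => hz (hB.1 h)
    have hC' : z ∉ C := fun h => hz (hC.1 h)
    have := congrArg (fun T => T.erase z) h
    simpa [hB', hC'] using this
  rw [← hinj.ncard_image, ← Set.ncard_union_eq]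
  · apply Set.ncard_le_ncard _ (Set.toFinite _)
    rintro B (hB | ⟨C, hC, rfl⟩)
    · exact ⟨hB.1.trans (Finset.subset_insert _ _), hB.2⟩
    · have hC' : z ∉ C := fun h => hz (hC.1 h)
      refine ⟨Finset.insert_subset_insert _ hC.1, ?_, ?_⟩
      · rw [← hC.2.1, Finset.coe_insert, Set.image_insert_eq, Submodule.span_insert, sup_assoc]
      · have h1 := hC.2.2
        have h2 : Module.finrank ℝ ↥(W ⊔ Submodule.span ℝ {X z}) = Module.finrank ℝ W + 1 := by
          have hz0 : X z ≠ 0 := fun h => hW (h ▸ W.zero_mem)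
          have h3 := Submodule.finrank_sup_add_finrank_inf_eq W (Submodule.span ℝ {X z})
          have h4 : W ⊓ Submodule.span ℝ {X z} = ⊥ := by
            rw [← disjoint_iff]
            exact (Submodule.disjoint_span_singleton' hz0).2 hW
          rw [h4, finrank_span_singleton hz0, finrank_bot] at h3
          omega
        rw [Finset.card_insert_of_notMem hC']
        omega
  · rw [Set.disjoint_left]
    rintro _ hB ⟨C, hC, rfl⟩
    exact hz (hB.1 (Finset.mem_insert_self _ _))

lemma rank_DD_le {n m : ℕ} (X : Fin m → Fin n → ℝ) (S : Finset (Fin m)) :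
    ∀ W : Submodule ℝ (Fin n → ℝ), Module.rank ℝ (DD X S W) ≤ ((BB X S W).ncard : Cardinal) := by
  classical
  induction S using Finset.induction_on with
  | empty =>
    intro W
    by_cases hW : W = ⊤
    · subst hW
      have h1 : BB X ∅ ⊤ = {∅} := by
        ext B
        simp only [BB, Set.mem_ofPred_eq, Finset.subset_empty, Set.mem_singleton_iff]
        constructor
        · exact fun h => h.1
        · rintro rfl; simp
      rw [h1, Set.ncard_singleton]
      have h2 : DD X ∅ ⊤ ≤ Submodule.span ℝ {(1 : MvPolynomial (Fin n) ℝ)} := by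
        intro f hf
        rw [const_of_pdirD f (fun a => hf.1 a trivial), Submodule.mem_span_singleton]
        exact ⟨_, by rw [MvPolynomial.smul_eq_C_mul, mul_one]⟩
      refine (Submodule.rank_mono h2).trans ?_
      refine (rank_span_le _).trans ?_
      simp
    · have : DD X ∅ W = ⊥ := by
        rw [eq_bot_iff]
        intro f hf
        have := hf.2 W le_rfl hW
        rw [Finset.filter_empty, piterD_empty] at this
        simpa using this
      rw [this]; simp
  | insert z S hz ih =>
    intro W
    by_cases hW : X z ∈ W
    · have h1 : DD X (insert z S) W ≤ DD X S W := by
        intro f hf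
        refine ⟨hf.1, fun H h1 h2 => ?_⟩
        have := hf.2 H h1 h2
        rwa [Finset.filter_insert, if_neg (by simpa using h1 hW)] at this
      refine (Submodule.rank_mono h1).trans ((ih W).trans ?_)
      rw [Nat.cast_le]
      apply Set.ncard_le_ncard _ (Set.toFinite _)
      intro B hB
      exact ⟨hB.1.trans (Finset.subset_insert _ _), hB.2⟩
    · refine le_trans ?_ (Nat.cast_le.2 (BB_step X S z hz W hW))
      set φ := (pdirD (X z)).domRestrict (DD X (insert z S) W) with hφ
      rw [← LinearMap.rank_range_add_rank_ker φ, Nat.cast_add]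
      refine add_le_add ?_ ?_
      · refine le_trans (Submodule.rank_mono ?_) (ih W)
        rintro _ ⟨⟨f, hf⟩, rfl⟩
        simp only [hφ, LinearMap.domRestrict_apply]
        refine ⟨fun w hw => ?_, fun H h1 h2 => ?_⟩
        · rw [← Module.End.mul_apply, (pdirD_comm _ _).eq, Module.End.mul_apply, hf.1 w hw,
            map_zero]
        · have h3 := hf.2 H h1 h2
          rw [← Module.End.mul_apply, ← (pdirD_piterD _ _ _).eq]
          rw [Finset.filter_insert] at h3
          split_ifs at h3 with h4
          · rw [Module.End.mul_apply, h3, map_zero]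
          · rw [← piterD_insert _ _ _ (by simp [hz])]
            exact h3
      · refine le_trans ?_ (ih _)
        rw [← LinearEquiv.rank_eq ((LinearMap.ker φ).equivMapOfInjective _
          (Submodule.injective_subtype _)).symm]
        refine Submodule.rank_mono ?_
        rintro _ ⟨⟨f, hf⟩, hk, rfl⟩
        have hk' : pdirD (X z) f = 0 := hk
        refine ⟨fun w hw => ?_, fun H h1 h2 => ?_⟩
        · obtain ⟨w1, hw1, w2, hw2, rfl⟩ := Submodule.mem_sup.1 hw
          obtain ⟨r, rfl⟩ := Submodule.mem_span_singleton.1 hw2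
          change pdirD _ f = 0
          rw [pdirD_add, pdirD_smul, LinearMap.add_apply, LinearMap.smul_apply, hf.1 _ hw1, hk']
          simp
        · have h3 := hf.2 H (le_sup_left.trans h1) h2
          have h4 : X z ∈ H := h1 (le_sup_right (a := W) (Submodule.mem_span_singleton_self _))
          rwa [Finset.filter_insert, if_neg (by simpa using h4)] at h3

lemma Dspace_le_DD {n m : ℕ} (X : Fin m → Fin n → ℝ)
    (hspan : Submodule.span ℝ (Set.range X) = ⊤) : Dspace X ≤ DD X Finset.univ ⊥ := by
  classical
  intro f hf
  refine ⟨fun w hw => ?_, fun H _ hH => ?_⟩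
  · rw [(Submodule.mem_bot ℝ).1 hw]; simp [pdirD]
  · let P : Finset (Finset (Fin m)) := Finset.univ.filter fun T =>
      (∀ i, X i ∈ H → i ∈ T) ∧ Submodule.span ℝ (X '' T) ≠ ⊤
    have hP : P.Nonempty := by
      refine ⟨Finset.univ.filter fun i => X i ∈ H, ?_⟩
      simp only [P, Finset.mem_filter, Finset.mem_univ, true_and]
      refine ⟨fun i hi => hi, fun h => hH ?_⟩
      rw [eq_top_iff, ← h, Submodule.span_le]
      rintro _ ⟨i, hi, rfl⟩
      simpa using hi
    obtain ⟨T, hT⟩ := P.exists_maximal hP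
    have hTP := hT.1
    simp only [P, Finset.mem_filter, Finset.mem_univ, true_and] at hTP
    set K := Submodule.span ℝ (X '' T) with hK
    have hex : ∃ i, X i ∉ K := by
      by_contra hc
      push Not at hc
      apply hTP.2
      rw [eq_top_iff, ← hspan, Submodule.span_le]
      rintro _ ⟨i, rfl⟩
      exact hc i
    obtain ⟨i, hi⟩ := hex
    have hiT : i ∉ T := fun h => hi (Submodule.subset_span ⟨i, h, rfl⟩)
    have htop : K ⊔ Submodule.span ℝ {X i} = ⊤ := by
      by_contra hc
      have hmem : insert i T ∈ P := by
        simp only [P, Finset.mem_filter, Finset.mem_univ, true_and]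
        refine ⟨fun j hj => Finset.mem_insert_of_mem (hTP.1 j hj), ?_⟩
        rwa [Finset.coe_insert, Set.image_insert_eq, Submodule.span_insert, sup_comm]
      exact hiT (hT.2 hmem (Finset.subset_insert _ _) (Finset.mem_insert_self _ _))
    have hrank : Module.finrank ℝ K + 1 = n := by
      have hz0 : X i ≠ 0 := fun h => hi (h ▸ K.zero_mem)
      have h3 := Submodule.finrank_sup_add_finrank_inf_eq K (Submodule.span ℝ {X i})
      have h4 : K ⊓ Submodule.span ℝ {X i} = ⊥ := by
        rw [← disjoint_iff]
        exact (Submodule.disjoint_span_singleton' hz0).2 hi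
      rw [h4, finrank_span_singleton hz0, finrank_bot, htop] at h3
      simpa using h3.symm
    have hco : IsCocircuit X (Finset.univ.filter fun i => X i ∉ K) := by
      refine ⟨K, ?_, hrank, by congr⟩
      apply le_antisymm
      · rw [hK, Submodule.span_le]
        rintro _ ⟨j, hj, rfl⟩
        exact Submodule.subset_span ⟨⟨j, rfl⟩, Submodule.subset_span ⟨j, hj, rfl⟩⟩
      · rw [Submodule.span_le]; exact Set.inter_subset_right
    have h5 : piterD X (Finset.univ.filter fun i => X i ∉ K) f = 0 := by
      simp only [Dspace, Submodule.mem_iInf] at hf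
      exact hf _ hco
    refine piterD_mono X ?_ f h5
    intro j hj
    simp only [Finset.mem_filter, Finset.mem_univ, true_and] at hj ⊢
    exact fun h => hj (Submodule.subset_span ⟨j, hTP.1 j h, rfl⟩)

lemma rank_Dspace_le {n m : ℕ} (X : Fin m → Fin n → ℝ)
    (hspan : Submodule.span ℝ (Set.range X) = ⊤) :
    Module.rank ℝ (Dspace X) ≤ (Set.ncard {S : Finset (Fin m) |
        S.card = n ∧ LinearIndependent ℝ (fun i : S => X i)} : Cardinal) := by
  refine (Submodule.rank_mono (Dspace_le_DD X hspan)).trans ((rank_DD_le X _ _).trans ?_)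
  rw [Nat.cast_le]
  apply Set.ncard_le_ncard _ (Set.toFinite _)
  rintro B ⟨-, h1, h2⟩
  rw [bot_sup_eq] at h1
  rw [finrank_bot, add_zero] at h2
  refine ⟨h2, linearIndependent_of_top_le_span_of_card_eq_finrank ?_ (by simp [h2])⟩
  rw [← h1, Set.image_eq_range]
  rfl

/-- Homogeneous terms of the exponential of the linear form `v`. -/
def Es {n : ℕ} (v : Fin n → ℝ) : ℤ → MvPolynomial (Fin n) ℝ
  | Int.ofNat k => ((k.factorial : ℝ)⁻¹) • (∑ i, v i • (MvPolynomial.X i)) ^ k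
  | Int.negSucc _ => 0

lemma pdirD_lin {n : ℕ} (a v : Fin n → ℝ) :
    pdirD a (∑ i, v i • (MvPolynomial.X i)) = MvPolynomial.C (a ⬝ᵥ v) := by
  rw [pdirD_apply, dotProduct, map_sum]
  refine Finset.sum_congr rfl fun i _ => ?_
  rw [map_sum, Finset.sum_eq_single i]
  · simp [MvPolynomial.smul_eq_C_mul]
  · intro j _ hj
    simp [MvPolynomial.pderiv_X_of_ne hj]
  · simp

lemma pdirD_pow {n : ℕ} (a : Fin n → ℝ) (p : MvPolynomial (Fin n) ℝ) (k : ℕ) :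
    pdirD a (p ^ (k + 1)) = (k + 1 : ℝ) • (p ^ k * pdirD a p) := by
  simp only [pdirD_apply, MvPolynomial.pderiv_pow, Finset.mul_sum, Finset.smul_sum]
  refine Finset.sum_congr rfl fun i _ => ?_
  simp only [MvPolynomial.smul_eq_C_mul]
  simp
  ring

lemma pdirD_Es {n : ℕ} (a v : Fin n → ℝ) (j : ℤ) :
    pdirD a (Es v (j + 1)) = (a ⬝ᵥ v) • Es v j := by
  rcases j with k | k
  · change pdirD a (Es v (Int.ofNat (k + 1))) = _
    simp only [Es]
    rw [map_smul, pdirD_pow, pdirD_lin, smul_smul, mul_comm (_ ^ k), ← MvPolynomial.smul_eq_C_mul,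
      smul_smul, smul_smul]
    congr 1
    rw [Nat.factorial_succ]
    push_cast
    field_simp
  · rcases k with _ | k
    · change pdirD a (Es v (Int.ofNat 0)) = _
      simp [Es, pdirD_apply]
    · have : Int.negSucc (k + 1) + 1 = Int.negSucc k := by omega
      rw [this]
      simp [Es]

/-- The shifted operators on formal series. -/
def TL {n m : ℕ} (X : Fin m → Fin n → ℝ) (c : Fin m → ℝ) :
    List (Fin m) → (ℤ → MvPolynomial (Fin n) ℝ) → ℤ → MvPolynomial (Fin n) ℝ
  | [], f => f
  | i :: L, f => fun j => pdirD (X i) (TL X c L f (j + 1)) - c i • TL X c L f j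

lemma TL_low {n m : ℕ} (X : Fin m → Fin n → ℝ) (c : Fin m → ℝ)
    (f : ℤ → MvPolynomial (Fin n) ℝ) (d : ℤ) (hf : ∀ j < d, f j = 0) (L : List (Fin m)) :
    (∀ j < d - L.length, TL X c L f j = 0) ∧
      TL X c L f (d - L.length) = (L.map fun i => pdirD (X i)).prod (f d) := by
  induction L with
  | nil => simpa [TL] using hf
  | cons i L ih =>
    refine ⟨fun j hj => ?_, ?_⟩
    · simp only [List.length_cons, Nat.cast_add, Nat.cast_one] at hj
      simp only [TL]
      rw [ih.1 _ (by omega), ih.1 _ (by omega)]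
      simp
    · simp only [TL, List.length_cons, Nat.cast_add, Nat.cast_one, List.map_cons, List.prod_cons,
        Module.End.mul_apply]
      rw [ih.1 (d - (L.length + 1)) (by omega), ← ih.2, smul_zero, sub_zero]
      congr 2
      omega

lemma TL_Es {n m : ℕ} (X : Fin m → Fin n → ℝ) (c : Fin m → ℝ) {ι : Type*} [Fintype ι]
    (v : ι → Fin n → ℝ) (a : ι → ℝ) (L : List (Fin m)) (j : ℤ) :
    TL X c L (fun j => ∑ b, a b • Es (v b) j) j =
      ∑ b, (a b * (L.map fun i => (X i ⬝ᵥ v b - c i)).prod) • Es (v b) j := by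
  induction L generalizing j with
  | nil => simp [TL]
  | cons i L ih =>
    simp only [TL, ih, map_sum, map_smul, pdirD_Es, Finset.smul_sum, ← Finset.sum_sub_distrib]
    refine Finset.sum_congr rfl fun b _ => ?_
    rw [smul_smul, smul_smul, ← sub_smul]
    congr 1
    simp
    ring

lemma Es_hom {n : ℕ} (v : Fin n → ℝ) (k : ℕ) :
    Es v (k : ℤ) ∈ MvPolynomial.homogeneousSubmodule (Fin n) ℝ k := by
  change Es v (Int.ofNat k) ∈ _
  simp only [Es]
  refine Submodule.smul_mem _ _ ?_
  rw [MvPolynomial.mem_homogeneousSubmodule]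
  have : (∑ i, v i • (MvPolynomial.X i : MvPolynomial (Fin n) ℝ)).IsHomogeneous 1 := by
    rw [← MvPolynomial.mem_homogeneousSubmodule]
    refine Submodule.sum_mem _ fun i _ => Submodule.smul_mem _ _ ?_
    exact MvPolynomial.isHomogeneous_X _ _
  simpa using this.pow k

lemma low_mem {n m : ℕ} (X : Fin m → Fin n → ℝ) (c : Fin m → ℝ) {ι : Type*} [Fintype ι]
    (v : ι → Fin n → ℝ)
    (hv : ∀ b S, IsCocircuit X S → ∃ i ∈ S, X i ⬝ᵥ v b = c i)
    (a : ι → ℝ) (d : ℤ) (hd : ∀ j < d, ∑ b, a b • Es (v b) j = 0) :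
    ∑ b, a b • Es (v b) d ∈ Dspace X := by
  simp only [Dspace, Submodule.mem_iInf]
  intro S hS
  rw [LinearMap.mem_ker, piterD, ← (TL_low X c (fun j => ∑ b, a b • Es (v b) j) d hd S.toList).2,
    TL_Es]
  refine Finset.sum_eq_zero fun b _ => ?_
  obtain ⟨i, hi, h⟩ := hv b S hS
  rw [List.prod_eq_zero, mul_zero, zero_smul]
  rw [List.mem_map]
  exact ⟨i, by simpa using hi, by rw [h, sub_self]⟩

lemma Es_indep {n : ℕ} {N : ℕ} (v : Fin N → Fin n → ℝ) (hv : Function.Injective v)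
    (a : Fin N → ℝ) (h : ∀ k < N, ∑ b, a b • Es (v b) (k : ℤ) = 0) : a = 0 := by
  obtain ⟨u, hu⟩ := Module.Dual.exists_forall_ne_zero_of_forall_exists
    (K := ℝ) (M := Fin n → ℝ) (ι := {p : Fin N × Fin N // p.1 ≠ p.2})
    (fun p => dotProductBilin ℝ ℝ (v p.1.1 - v p.1.2)) (by
      rintro ⟨⟨b, b'⟩, hb⟩
      refine ⟨v b - v b', ?_⟩
      simp only [dotProductBilin_apply_apply]
      rw [Ne, dotProduct_self_eq_zero, sub_eq_zero]
      exact fun h => hb (hv h))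
  apply Matrix.eq_zero_of_forall_pow_sum_mul_pow_eq_zero (f := fun b => v b ⬝ᵥ u)
  · intro b b' hbb
    by_contra hne
    apply hu ⟨(b, b'), hne⟩
    simpa [sub_dotProduct, sub_eq_zero] using hbb
  · intro k
    have h1 := congrArg (MvPolynomial.eval u) (h k k.2)
    have h2 : ∀ b, MvPolynomial.eval u (Es (v b) ((k : ℕ) : ℤ))
        = ((k : ℕ).factorial : ℝ)⁻¹ * (v b ⬝ᵥ u) ^ (k : ℕ) := by
      intro b
      change MvPolynomial.eval u (Es (v b) (Int.ofNat k)) = _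
      simp [Es, MvPolynomial.smul_eval, dotProduct]
    rw [map_sum, map_zero] at h1
    simp only [MvPolynomial.smul_eval, h2] at h1
    have h3 : ((k : ℕ).factorial : ℝ)⁻¹ ≠ 0 := by positivity
    apply (mul_eq_zero.1 _).resolve_left h3
    rw [← h1, Finset.mul_sum]
    refine Finset.sum_congr rfl fun b _ => ?_
    ring

lemma exists_proj {n : ℕ} (P : Submodule ℝ (MvPolynomial (Fin n) ℝ)) :
    ∃ p : MvPolynomial (Fin n) ℝ →ₗ[ℝ] MvPolynomial (Fin n) ℝ,
      (∀ f, p f ∈ P) ∧ ∀ f ∈ P, p f = f := by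
  obtain ⟨q, hq⟩ := P.exists_isCompl
  refine ⟨P.subtype ∘ₗ P.projectionOnto q hq, fun f => by simp, fun f hf => ?_⟩
  have := P.projectionOnto_apply_left hq ⟨f, hf⟩
  simp at this
  simp [this]

lemma card_le {n m : ℕ} (X : Fin m → Fin n → ℝ) (c : Fin m → ℝ) {N : ℕ}
    (v : Fin N → Fin n → ℝ) (hinj : Function.Injective v)
    (hv : ∀ b S, IsCocircuit X S → ∃ i ∈ S, X i ⬝ᵥ v b = c i)
    [Module.Finite ℝ (Dspace X)] : N ≤ Module.finrank ℝ (Dspace X) := by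
  choose p hp1 hp2 using fun d : ℕ =>
    exists_proj (Dspace X ⊓ MvPolynomial.homogeneousSubmodule (Fin n) ℝ d)
  let F : ℕ → (Fin N → ℝ) →ₗ[ℝ] MvPolynomial (Fin n) ℝ := fun d =>
    Fintype.linearCombination ℝ (fun b => Es (v b) (d : ℤ))
  have hF : ∀ d a, F d a = ∑ b, a b • Es (v b) (d : ℤ) := fun d a => by
    simp [F, Fintype.linearCombination_apply]
  let Φ : (Fin N → ℝ) →ₗ[ℝ] MvPolynomial (Fin n) ℝ := ∑ d ∈ Finset.range N, (p d) ∘ₗ F d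
  have hΦ : ∀ a, Φ a = ∑ d ∈ Finset.range N, p d (F d a) := fun a => by
    simp [Φ, LinearMap.sum_apply]
  have hmem : ∀ a, Φ a ∈ Dspace X := fun a => by
    rw [hΦ]
    exact Submodule.sum_mem _ fun d _ => (hp1 d _).1
  have hΦinj : Function.Injective (Φ.codRestrict (Dspace X) hmem) := by
    rw [injective_iff_map_eq_zero]
    intro a ha
    have ha' : Φ a = 0 := congrArg Subtype.val ha
    apply Es_indep v hinj
    intro k
    induction k using Nat.strong_induction_on with
    | _ k ih =>
      intro hk
      have hD : F k a ∈ Dspace X := by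
        rw [hF]
        refine low_mem X c v hv a k fun j hj => ?_
        rcases j with j | j
        · exact ih j (by simpa using hj) (lt_trans (by simpa using hj) hk)
        · simp [Es]
      have hH : F k a ∈ MvPolynomial.homogeneousSubmodule (Fin n) ℝ k := by
        rw [hF]
        exact Submodule.sum_mem _ fun b _ => Submodule.smul_mem _ _ (Es_hom _ _)
      have h1 := congrArg (MvPolynomial.homogeneousComponent k) ha'
      rw [hΦ, map_sum, map_zero, Finset.sum_eq_single k] at h1
      · rw [hp2 k _ ⟨hD, hH⟩, MvPolynomial.homogeneousComponent_of_mem hH, if_pos rfl, hF] at h1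
        exact h1
      · intro d _ hdk
        rw [MvPolynomial.homogeneousComponent_of_mem (hp1 d _).2, if_neg (Ne.symm hdk)]
      · intro h; exact absurd (Finset.mem_range.2 hk) h
  have := LinearMap.finrank_le_finrank_of_injective hΦinj
  simpa using this

lemma exists_points {n m : ℕ} (X : Fin m → Fin n → ℝ) :
    ∃ (c : Fin m → ℝ) (v : {S : Finset (Fin m) |
        S.card = n ∧ LinearIndependent ℝ (fun i : S => X i)} → Fin n → ℝ),
      Function.Injective v ∧ ∀ B, ∀ i ∈ B.1, X i ⬝ᵥ v B = c i := by
  classical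
  set Bs := {S : Finset (Fin m) | S.card = n ∧ LinearIndependent ℝ (fun i : S => X i)} with hBs
  have hspan : ∀ B : Bs, Submodule.span ℝ (Set.range fun i : B.1 => X i) = ⊤ := fun B =>
    B.2.2.span_eq_top_of_card_eq_finrank' (by simp [B.2.1])
  have hcomb : ∀ B : Bs, ∀ i, ∃ r : B.1 → ℝ, ∑ j, r j • X j = X i := by
    intro B i
    have : X i ∈ Submodule.span ℝ (Set.range fun i : B.1 => X i) := by rw [hspan]; trivial
    exact (Submodule.mem_span_range_iff_exists_fun ℝ).1 this
  choose r hr using hcomb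
  obtain ⟨c, hc⟩ := Module.Dual.exists_forall_ne_zero_of_forall_exists
    (K := ℝ) (M := Fin m → ℝ) (ι := {p : Bs × Fin m // p.2 ∉ p.1.1})
    (fun p => LinearMap.proj p.1.2 - ∑ j, r p.1.1 p.1.2 j • LinearMap.proj (j : Fin m)) (by
      rintro ⟨⟨B, i⟩, hi⟩
      refine ⟨Pi.single i 1, ?_⟩
      have h0 : ∑ j, r B i j * (Pi.single i (1 : ℝ) : Fin m → ℝ) (j : Fin m) = 0 := by
        refine Finset.sum_eq_zero fun j _ => ?_
        have : (j : Fin m) ≠ i := fun h => hi (h ▸ j.2)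
        simp [this]
      simp [LinearMap.sum_apply] at h0 ⊢
      simp [h0])
  have hsol : ∀ B : Bs, ∃ v : Fin n → ℝ, ∀ i ∈ B.1, X i ⬝ᵥ v = c i := by
    intro B
    let b := Module.Basis.mk B.2.2 (hspan B).ge
    let φ : Module.Dual ℝ (Fin n → ℝ) := b.constr ℝ (fun i : B.1 => c i)
    refine ⟨fun k => φ (Pi.single k 1), fun i hi => ?_⟩
    have h1 : φ (X i) = c i := by
      have := b.constr_basis ℝ (fun i : B.1 => c i) ⟨i, hi⟩
      simpa [b, φ] using this
    rw [← h1, dotProduct]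
    conv_rhs => rw [pi_eq_sum_univ' (X i), map_sum]
    simp only [map_smul, smul_eq_mul]
  choose v hv using hsol
  refine ⟨c, v, ?_, hv⟩
  intro B B' h
  by_contra hne
  have : ∃ i ∈ B'.1, i ∉ B.1 := by
    by_contra hcon
    push Not at hcon
    apply hne
    apply Subtype.ext
    exact (Finset.eq_of_subset_of_card_le (fun i hi => hcon i hi)
      (by rw [B.2.1, B'.2.1])).symm
  obtain ⟨i, hi', hi⟩ := this
  apply hc ⟨(B, i), hi⟩
  have h1 : X i ⬝ᵥ v B = c i := by rw [h]; exact hv B' i hi'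
  rw [← hr B i, sum_dotProduct] at h1
  simp only [smul_dotProduct, smul_eq_mul] at h1
  simp only [LinearMap.sub_apply, LinearMap.sum_apply, LinearMap.smul_apply, LinearMap.proj_apply,
    smul_eq_mul]
  rw [← h1, sub_eq_zero]
  refine Finset.sum_congr rfl fun j _ => ?_
  rw [hv B j j.2]

lemma meets {n m : ℕ} (X : Fin m → Fin n → ℝ) (B S : Finset (Fin m)) (hB : B.card = n)
    (hli : LinearIndependent ℝ (fun i : B => X i)) (hS : IsCocircuit X S) :
    ∃ i ∈ B, i ∈ S := by
  classical
  obtain ⟨H, -, hr, rfl⟩ := hS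
  by_contra hcon
  push Not at hcon
  have hspan : Submodule.span ℝ (Set.range fun i : B => X i) = ⊤ :=
    hli.span_eq_top_of_card_eq_finrank' (by simp [hB])
  have : H = ⊤ := by
    rw [eq_top_iff, ← hspan, Submodule.span_le]
    rintro _ ⟨i, rfl⟩
    have := hcon i i.2
    simpa using this
  rw [this] at hr
  simp at hr

end helpers

theorem stmt1 {n m : ℕ} (X : Fin m → Fin n → ℝ)
    (hX0 : ∀ i, X i ≠ 0)
    (hspan : Submodule.span ℝ (Set.range X) = ⊤) :
    Module.finrank ℝ (Dspace X) =
      Set.ncard {S : Finset (Fin m) |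
        S.card = n ∧ LinearIndependent ℝ (fun i : S => X i)} := by
  have hle := rank_Dspace_le X hspan
  haveI hfin : Module.Finite ℝ (Dspace X) :=
    Module.rank_lt_aleph0_iff.1 (hle.trans_lt (Cardinal.natCast_lt_aleph0))
  apply le_antisymm
  · rw [← Module.finrank_eq_rank] at hle
    exact_mod_cast hle
  · obtain ⟨c, v, hinj, hv⟩ := exists_points X
    rw [← Nat.card_coe_set_eq]
    let e := (Finite.equivFin {S : Finset (Fin m) |
        S.card = n ∧ LinearIndependent ℝ (fun i : S => X i)}).symm
    refine card_le X c (v ∘ e) (hinj.comp e.injective) fun b S hS => ?_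
    obtain ⟨i, hi, hi'⟩ := meets X (e b).1 S (e b).2.1 (e b).2.2 hS
    exact ⟨i, hi', hv _ i hi⟩
end
end

section
/- The ideal I_X generated by the cocircuit products d_Y defines a scheme supported at the origin, and dim_ℝ S[g*]/I_X equals d(X), the number of bases of g* extractable from X. -/
/-!
STATEMENT 10: The ideal I_X of S[g*] generated by the cocircuit products d_Y
defines a scheme supported at the origin (its radical is the maximal ideal of
the origin), and dim_ℝ S[g*]/I_X equals d(X), the number of bases of g*
extractable from X.
-/

noncomputable section

open scoped BigOperators

/-- The linear polynomial attached to the vector `a` of g*. -/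
def linP {n : ℕ} (a : Fin n → ℝ) : MvPolynomial (Fin n) ℝ :=
  ∑ i, MvPolynomial.C (a i) * MvPolynomial.X i

/-- d_Y = ∏_{a ∈ Y} a for the sublist Y of X indexed by S. -/
def dP {n m : ℕ} (X : Fin m → Fin n → ℝ) (S : Finset (Fin m)) :
    MvPolynomial (Fin n) ℝ :=
  ∏ i ∈ S, linP (X i)

/-- The cocircuit ideal I_X. -/
def IX {n m : ℕ} (X : Fin m → Fin n → ℝ) : Ideal (MvPolynomial (Fin n) ℝ) :=
  Ideal.span {p | ∃ S : Finset (Fin m), IsCocircuit X S ∧ p = dP X S}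

open MvPolynomial in
theorem linP_single {n : ℕ} (i : Fin n) : linP (Pi.single i (1:ℝ)) = MvPolynomial.X i := by
  unfold linP
  rw [Finset.sum_eq_single i]
  · simp
  · intro j _ hj
    simp [Pi.single_eq_of_ne hj]
  · simp

theorem linP_zero {n : ℕ} : linP (0 : Fin n → ℝ) = 0 := by
  simp [linP]

theorem linP_add {n : ℕ} (u v : Fin n → ℝ) : linP (u + v) = linP u + linP v := by
  simp [linP, add_mul, Finset.sum_add_distrib]

theorem linP_smul {n : ℕ} (c : ℝ) (v : Fin n → ℝ) :
    linP (c • v) = MvPolynomial.C c * linP v := by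
  simp [linP, Finset.mul_sum, mul_assoc]

theorem linP_hom {n : ℕ} (u : Fin n → ℝ) : (linP u).IsHomogeneous 1 := by
  unfold linP
  apply MvPolynomial.IsHomogeneous.sum
  intro i _
  simpa using (MvPolynomial.isHomogeneous_C (Fin n) (u i)).mul (MvPolynomial.isHomogeneous_X ℝ i)

theorem dP_hom {n m : ℕ} (X : Fin m → Fin n → ℝ) (S : Finset (Fin m)) :
    (dP X S).IsHomogeneous S.card := by
  have := MvPolynomial.IsHomogeneous.prod S (fun i => linP (X i)) (fun _ => 1)
    (fun i _ => linP_hom (X i))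
  simpa [dP] using this

/-- Rational hyperplanes for the sublist `A` after contraction of `U`. -/
def RatHyp {n m : ℕ} (X : Fin m → Fin n → ℝ) (A : Finset (Fin m))
    (U H : Submodule ℝ (Fin n → ℝ)) : Prop :=
  U ≤ H ∧ H ≤ U ⊔ Submodule.span ℝ (X '' {i | i ∈ A ∧ X i ∈ H}) ∧ Module.finrank ℝ H + 1 = n

open Classical in
/-- The relative cocircuit ideal. -/
def relI {n m : ℕ} (X : Fin m → Fin n → ℝ) (A : Finset (Fin m))
    (U : Submodule ℝ (Fin n → ℝ)) : Ideal (MvPolynomial (Fin n) ℝ) :=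
  Ideal.span ({p | ∃ u ∈ U, p = linP u} ∪
    {p | ∃ H, RatHyp X A U H ∧ p = dP X (A.filter (fun i => X i ∉ H))})

open Classical in
/-- The relative bases. -/
def relB {n m : ℕ} (X : Fin m → Fin n → ℝ) (A : Finset (Fin m))
    (U : Submodule ℝ (Fin n → ℝ)) : Finset (Finset (Fin m)) :=
  A.powerset.filter (fun b => b.card + Module.finrank ℝ U = n ∧
    U ⊔ Submodule.span ℝ (X '' (b : Set (Fin m))) = ⊤)

theorem relI_lin {n m : ℕ} (X : Fin m → Fin n → ℝ) (A : Finset (Fin m))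
    (U : Submodule ℝ (Fin n → ℝ)) {u} (hu : u ∈ U) : linP u ∈ relI X A U :=
  Ideal.subset_span (Or.inl ⟨u, hu, rfl⟩)

open Classical in
theorem relI_cocirc {n m : ℕ} (X : Fin m → Fin n → ℝ) (A : Finset (Fin m))
    (U : Submodule ℝ (Fin n → ℝ)) {H} (hH : RatHyp X A U H) :
    dP X (A.filter (fun i => X i ∉ H)) ∈ relI X A U :=
  Ideal.subset_span (Or.inr ⟨H, hH, rfl⟩)

theorem RatHyp.mono {n m : ℕ} {X : Fin m → Fin n → ℝ} {A A' : Finset (Fin m)} (h : A ⊆ A')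
    {U H : Submodule ℝ (Fin n → ℝ)} (hH : RatHyp X A U H) : RatHyp X A' U H := by
  refine ⟨hH.1, hH.2.1.trans ?_, hH.2.2⟩
  apply sup_le_sup_left
  apply Submodule.span_mono
  apply Set.image_mono
  exact fun i hi => ⟨h hi.1, hi.2⟩

theorem mul_relI {n m : ℕ} (X : Fin m → Fin n → ℝ) (A : Finset (Fin m))
    (U : Submodule ℝ (Fin n → ℝ)) (a : Fin m) (ha : a ∉ A) (f) (hf : f ∈ relI X A U) :
    linP (X a) * f ∈ relI X (insert a A) U := by
  classical
  unfold relI at hf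
  induction hf using Submodule.span_induction with
  | mem x hx =>
    rcases hx with ⟨u, hu, rfl⟩ | ⟨H, hH, rfl⟩
    · exact Ideal.mul_mem_left _ _ (relI_lin X _ U hu)
    · have h := relI_cocirc X (insert a A) U (hH.mono (Finset.subset_insert a A))
      rw [Finset.filter_insert] at h
      by_cases hc : X a ∈ H
      · rw [if_neg (by simpa using hc)] at h
        exact Ideal.mul_mem_left _ _ h
      · rw [if_pos hc] at h
        have e : dP X (insert a (A.filter (fun i => X i ∉ H))) =
          linP (X a) * dP X (A.filter (fun i => X i ∉ H)) := by
          unfold dP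
          rw [Finset.prod_insert]
          simp [ha]
        rw [← e]
        exact h
  | zero => simp
  | add x y _ _ hx hy => rw [mul_add]; exact Ideal.add_mem _ hx hy
  | smul c x _ hx =>
    rw [smul_eq_mul, mul_left_comm]
    exact Ideal.mul_mem_left _ _ hx

theorem relI_contract {n m : ℕ} (X : Fin m → Fin n → ℝ) (A : Finset (Fin m))
    (U : Submodule ℝ (Fin n → ℝ)) (a : Fin m) :
    relI X A (U ⊔ Submodule.span ℝ {X a}) ≤ relI X (insert a A) U ⊔ Ideal.span {linP (X a)} := by
  classical
  refine Ideal.span_le.2 ?_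
  rintro x (⟨u, hu, rfl⟩ | ⟨H, hH, rfl⟩)
  · rw [Submodule.mem_sup] at hu
    obtain ⟨y, hy, z, hz, rfl⟩ := hu
    obtain ⟨c, rfl⟩ := Submodule.mem_span_singleton.1 hz
    rw [linP_add, linP_smul]
    apply Ideal.add_mem
    · exact Ideal.mem_sup_left (relI_lin X _ U hy)
    · exact Ideal.mem_sup_right (Ideal.mul_mem_left _ _ (Ideal.mem_span_singleton_self _))
  · apply Ideal.mem_sup_left
    have haH : X a ∈ H :=
      hH.1 (Submodule.mem_sup_right (Submodule.mem_span_singleton_self _))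
    have h2 : RatHyp X (insert a A) U H := by
      refine ⟨le_sup_left.trans hH.1, hH.2.1.trans ?_, hH.2.2⟩
      refine sup_le (sup_le le_sup_left ?_) ?_
      · refine le_trans ?_ le_sup_right
        rw [Submodule.span_singleton_le_iff_mem]
        exact Submodule.subset_span ⟨a, ⟨by simp, haH⟩, rfl⟩
      · refine le_trans ?_ le_sup_right
        apply Submodule.span_mono
        apply Set.image_mono
        exact fun i hi => ⟨Finset.mem_insert_of_mem hi.1, hi.2⟩
    have h := relI_cocirc X (insert a A) U h2
    rw [Finset.filter_insert, if_neg (by simpa using haH)] at h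
    exact h

theorem relI_loop {n m : ℕ} (X : Fin m → Fin n → ℝ) (A : Finset (Fin m))
    (U : Submodule ℝ (Fin n → ℝ)) (a : Fin m) (ha : X a ∈ U) :
    relI X A U ≤ relI X (insert a A) U := by
  classical
  refine Ideal.span_le.2 ?_
  rintro x (⟨u, hu, rfl⟩ | ⟨H, hH, rfl⟩)
  · exact relI_lin X _ U hu
  · have h := relI_cocirc X (insert a A) U (hH.mono (Finset.subset_insert a A))
    rw [Finset.filter_insert, if_neg (by simpa using hH.1 ha)] at h
    exact h

theorem finrank_sup_sing {n : ℕ} (U : Submodule ℝ (Fin n → ℝ)) (v : Fin n → ℝ) (hv : v ∉ U) :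
    Module.finrank ℝ (U ⊔ Submodule.span ℝ {v} : Submodule ℝ (Fin n → ℝ)) =
      Module.finrank ℝ U + 1 := by
  have h0 : v ≠ 0 := by rintro rfl; exact hv U.zero_mem
  have h := Submodule.finrank_sup_add_finrank_inf_eq U (Submodule.span ℝ {v})
  have hd : U ⊓ Submodule.span ℝ {v} = ⊥ := by
    rw [← disjoint_iff]
    rw [Submodule.disjoint_span_singleton]
    intro hvU; exact absurd hvU hv
  rw [hd, finrank_bot, finrank_span_singleton h0] at h
  simpa using h

theorem relB_rec {n m : ℕ} (X : Fin m → Fin n → ℝ) (A : Finset (Fin m))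
    (U : Submodule ℝ (Fin n → ℝ)) (a : Fin m) (ha : a ∉ A) (haU : X a ∉ U) :
    (relB X A U).card + (relB X A (U ⊔ Submodule.span ℝ {X a})).card ≤
      (relB X (insert a A) U).card := by
  classical
  have hfr := finrank_sup_sing U (X a) haU
  have hinj : Set.InjOn (fun b : Finset (Fin m) => insert a b)
      (relB X A (U ⊔ Submodule.span ℝ {X a}) : Set (Finset (Fin m))) := by
    intro b hb c hc h
    simp only [relB, Finset.coe_filter, Finset.mem_powerset, Set.mem_ofPred_eq] at hb hc
    have h1 : a ∉ b := fun h => ha (hb.1 h)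
    have h2 : a ∉ c := fun h => ha (hc.1 h)
    have := congrArg (fun s => s.erase a) h
    simpa [Finset.erase_insert h1, Finset.erase_insert h2] using this
  rw [← Finset.card_image_of_injOn hinj, ← Finset.card_union_of_disjoint]
  · apply Finset.card_le_card
    intro b hb
    rw [Finset.mem_union] at hb
    rcases hb with hb | hb
    · simp only [relB, Finset.mem_filter, Finset.mem_powerset] at hb ⊢
      exact ⟨hb.1.trans (Finset.subset_insert _ _), hb.2⟩
    · rw [Finset.mem_image] at hb
      obtain ⟨c, hc, rfl⟩ := hb
      simp only [relB, Finset.mem_filter, Finset.mem_powerset] at hc ⊢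
      have h1 : a ∉ c := fun h => ha (hc.1 h)
      refine ⟨Finset.insert_subset_insert _ hc.1, ?_, ?_⟩
      · rw [Finset.card_insert_of_notMem h1]
        have := hc.2.1
        omega
      · rw [Finset.coe_insert, Set.image_insert_eq, Submodule.span_insert, ← sup_assoc]
        exact hc.2.2
  · rw [Finset.disjoint_left]
    intro b hb hb2
    rw [Finset.mem_image] at hb2
    obtain ⟨c, hc, rfl⟩ := hb2
    simp only [relB, Finset.mem_filter, Finset.mem_powerset] at hb
    exact ha (hb.1 (Finset.mem_insert_self a c))

theorem upper {n m : ℕ} (X : Fin m → Fin n → ℝ) (A : Finset (Fin m)) :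
    ∀ U : Submodule ℝ (Fin n → ℝ), U ⊔ Submodule.span ℝ (X '' (A : Set (Fin m))) = ⊤ →
    ∃ B : Finset (MvPolynomial (Fin n) ℝ), (∀ b ∈ B, ∃ k, b.IsHomogeneous k) ∧
      B.card ≤ (relB X A U).card ∧
      ∀ f, ∃ w ∈ Submodule.span ℝ (B : Set (MvPolynomial (Fin n) ℝ)), f - w ∈ relI X A U := by
  classical
  induction A using Finset.induction_on with
  | empty =>
    intro U hU
    have hU : U = ⊤ := by simpa using hU
    subst hU
    refine ⟨{1}, ?_, ?_, ?_⟩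
    · intro b hb
      rw [Finset.mem_singleton] at hb
      subst hb
      exact ⟨0, MvPolynomial.isHomogeneous_one _ _⟩
    · rw [Finset.card_singleton, Nat.succ_le_iff, Finset.card_pos]
      exact ⟨∅, by simp [relB]⟩
    · intro f
      induction f using MvPolynomial.induction_on with
      | C a =>
        refine ⟨MvPolynomial.C a, ?_, by simp⟩
        rw [Finset.coe_singleton, Submodule.mem_span_singleton]
        exact ⟨a, by rw [MvPolynomial.smul_eq_C_mul, mul_one]⟩
      | add p q hp hq =>
        obtain ⟨w, hw, h⟩ := hp
        obtain ⟨w', hw', h'⟩ := hq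
        refine ⟨w + w', Submodule.add_mem _ hw hw', ?_⟩
        rw [add_sub_add_comm]
        exact Ideal.add_mem _ h h'
      | mul_X p i hp =>
        refine ⟨0, Submodule.zero_mem _, ?_⟩
        rw [sub_zero, ← linP_single]
        exact Ideal.mul_mem_left _ _ (relI_lin X _ _ Submodule.mem_top)
  | insert a A ha ih =>
    intro U hU
    rw [Finset.coe_insert, Set.image_insert_eq, Submodule.span_insert, ← sup_assoc] at hU
    by_cases haU : X a ∈ U
    · have : U ⊔ Submodule.span ℝ {X a} = U := by
        rw [sup_eq_left, Submodule.span_singleton_le_iff_mem]; exact haU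
      rw [this] at hU
      obtain ⟨B, h1, h2, h3⟩ := ih U hU
      refine ⟨B, h1, h2.trans ?_, fun f => ?_⟩
      · apply Finset.card_le_card
        intro b hb
        simp only [relB, Finset.mem_filter, Finset.mem_powerset] at hb ⊢
        exact ⟨hb.1.trans (Finset.subset_insert _ _), hb.2⟩
      · obtain ⟨w, hw, h⟩ := h3 f
        exact ⟨w, hw, relI_loop X A U a haU h⟩
    · obtain ⟨B2, h1, h2, h3⟩ := ih _ hU
      have key : ∃ B : Finset (MvPolynomial (Fin n) ℝ), (∀ b ∈ B, ∃ k, b.IsHomogeneous k) ∧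
          B.card ≤ (relB X A U).card ∧
          ∀ f, ∃ w ∈ Submodule.span ℝ (B : Set (MvPolynomial (Fin n) ℝ)),
            f - w ∈ relI X A U := by
        by_cases hs : U ⊔ Submodule.span ℝ (X '' (A : Set (Fin m))) = ⊤
        · exact ih U hs
        · refine ⟨∅, by simp, by simp, fun f => ⟨0, Submodule.zero_mem _, ?_⟩⟩
          set H := U ⊔ Submodule.span ℝ (X '' (A : Set (Fin m))) with hH
          have hA : ∀ i ∈ A, X i ∈ H := fun i hi =>
            Submodule.mem_sup_right (Submodule.subset_span ⟨i, hi, rfl⟩)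
          have hU' : H ⊔ Submodule.span ℝ {X a} = ⊤ := by
            rw [← hU, hH, sup_assoc, sup_assoc, sup_comm (Submodule.span ℝ {X a})]
          have haH : X a ∉ H := by
            intro h
            apply hs
            rw [← hU']
            symm
            rw [sup_eq_left, Submodule.span_singleton_le_iff_mem]; exact h
          have hr : RatHyp X A U H := by
            refine ⟨le_sup_left, ?_, ?_⟩
            · rw [hH]
              apply sup_le_sup_left
              apply Submodule.span_mono
              apply Set.image_mono
              exact fun i hi => ⟨hi, hA i hi⟩
            · rw [← finrank_sup_sing H (X a) haH, hU']
              simp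
          have h := relI_cocirc X A U hr
          rw [Finset.filter_false_of_mem (by simpa using hA)] at h
          have h1 : (1 : MvPolynomial (Fin n) ℝ) ∈ relI X A U := by simpa [dP] using h
          rw [(Ideal.eq_top_iff_one _).2 h1]
          trivial
      obtain ⟨B1, g1, g2, g3⟩ := key
      refine ⟨B1.image (fun f => linP (X a) * f) ∪ B2, ?_, ?_, ?_⟩
      · intro b hb
        rw [Finset.mem_union] at hb
        rcases hb with hb | hb
        · rw [Finset.mem_image] at hb
          obtain ⟨c, hc, rfl⟩ := hb
          obtain ⟨k, hk⟩ := g1 c hc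
          exact ⟨1 + k, (linP_hom _).mul hk⟩
        · exact h1 b hb
      · refine (Finset.card_union_le _ _).trans (le_trans ?_ (relB_rec X A U a ha haU))
        exact add_le_add (Finset.card_image_le.trans g2) h2
      · intro f
        obtain ⟨w2, hw2, hi2⟩ := h3 f
        have h := relI_contract X A U a hi2
        rw [Submodule.mem_sup] at h
        obtain ⟨i, hi, j, hj, hij⟩ := h
        obtain ⟨g, rfl⟩ := Ideal.mem_span_singleton'.1 hj
        obtain ⟨w1, hw1, hi1⟩ := g3 g
        have hm := mul_relI X A U a ha _ hi1
        refine ⟨linP (X a) * w1 + w2, ?_, ?_⟩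
        · apply Submodule.add_mem
          · have : linP (X a) * w1 ∈ (Submodule.span ℝ (B1 : Set (MvPolynomial (Fin n) ℝ))).map
              (LinearMap.mulLeft ℝ (linP (X a))) := ⟨w1, hw1, rfl⟩
            rw [Submodule.map_span] at this
            refine Submodule.span_mono ?_ this
            rintro _ ⟨y, hy, rfl⟩
            simp only [Finset.coe_union, Finset.coe_image]
            exact Or.inl ⟨y, hy, rfl⟩
          · exact Submodule.span_mono (by simp) hw2
        · have e : f - (linP (X a) * w1 + w2) = i + linP (X a) * (g - w1) := by
            linear_combination -hij
          rw [e]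
          exact Ideal.add_mem _ hi hm

/-- Polynomials of degree less than `k`. -/
def LL (n k : ℕ) : Submodule ℝ (MvPolynomial (Fin n) ℝ) :=
  MvPolynomial.restrictSupport ℝ {d | d.degree < k}

theorem mem_LL {n k : ℕ} {p : MvPolynomial (Fin n) ℝ} :
    p ∈ LL n k ↔ ∀ d, p.coeff d ≠ 0 → d.degree < k := by
  unfold LL
  rw [MvPolynomial.mem_restrictSupport_iff]
  simp [Set.subset_def]

theorem LL_mono {n k l : ℕ} (h : k ≤ l) : LL n k ≤ LL n l := by
  intro p hp
  rw [mem_LL] at *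
  exact fun d hd => (hp d hd).trans_le h

theorem degree_of_hom {n k : ℕ} {p : MvPolynomial (Fin n) ℝ} (hp : p.IsHomogeneous k)
    {d : Fin n →₀ ℕ} (hd : p.coeff d ≠ 0) : d.degree = k := by
  have h := hp hd
  have e := congrArg (fun f => f d) (Finsupp.degree_eq_weight_one (R := ℕ) (σ := Fin n))
  exact e.trans h

theorem hom_LL {n k l : ℕ} (h : k < l) {p : MvPolynomial (Fin n) ℝ} (hp : p.IsHomogeneous k) :
    p ∈ LL n l := by
  rw [mem_LL]
  intro d hd
  have := (degree_of_hom hp hd)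
  omega

theorem hom_mul_LL {n k l : ℕ} {p q : MvPolynomial (Fin n) ℝ} (hp : p.IsHomogeneous k)
    (hq : q ∈ LL n l) : p * q ∈ LL n (k + l) := by
  classical
  rw [mem_LL] at *
  intro d hd
  have hd' := MvPolynomial.mem_support_iff.2 hd
  have := MvPolynomial.support_mul _ _ hd'
  rw [Finset.mem_add] at this
  obtain ⟨a, ha, b, hb, rfl⟩ := this
  have h1 := degree_of_hom hp (MvPolynomial.mem_support_iff.1 ha)
  have h2 := hq b (MvPolynomial.mem_support_iff.1 hb)
  rw [map_add]
  omega

/-- The deformed products. -/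
def dL {n m : ℕ} (X : Fin m → Fin n → ℝ) (l : Fin m → ℝ) (S : Finset (Fin m)) :
    MvPolynomial (Fin n) ℝ :=
  ∏ i ∈ S, (linP (X i) - MvPolynomial.C (l i))

/-- The deformed cocircuit ideal. -/
def JX {n m : ℕ} (X : Fin m → Fin n → ℝ) (l : Fin m → ℝ) : Ideal (MvPolynomial (Fin n) ℝ) :=
  Ideal.span {p | ∃ S : Finset (Fin m), IsCocircuit X S ∧ p = dL X l S}

theorem dL_sub {n m : ℕ} (X : Fin m → Fin n → ℝ) (l : Fin m → ℝ) (S : Finset (Fin m)) :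
    dP X S - dL X l S ∈ LL n S.card := by
  classical
  induction S using Finset.induction_on with
  | empty => simp [dP, dL]
  | insert a S ha ih =>
    have e : dP X (insert a S) - dL X l (insert a S) =
        linP (X a) * (dP X S - dL X l S) + MvPolynomial.C (l a) * (dP X S) -
          MvPolynomial.C (l a) * (dP X S - dL X l S) := by
      unfold dP dL
      rw [Finset.prod_insert ha, Finset.prod_insert ha]
      ring
    rw [e, Finset.card_insert_of_notMem ha]
    refine Submodule.sub_mem _ (Submodule.add_mem _ ?_ ?_) ?_
    · rw [add_comm]; exact hom_mul_LL (linP_hom _) ih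
    · rw [← MvPolynomial.smul_eq_C_mul]
      exact Submodule.smul_mem _ _ (hom_LL (Nat.lt_succ_self _) (dP_hom X S))
    · rw [← MvPolynomial.smul_eq_C_mul]
      exact Submodule.smul_mem _ _ (LL_mono (Nat.le_succ _) ih)

/-- Degree `k` part of the cocircuit ideal. -/
def IXk {n m : ℕ} (X : Fin m → Fin n → ℝ) (k : ℕ) : Submodule ℝ (MvPolynomial (Fin n) ℝ) :=
  Submodule.span ℝ {p | ∃ (s : Fin n →₀ ℕ) (S : Finset (Fin m)), IsCocircuit X S ∧
    s.degree + S.card = k ∧ p = MvPolynomial.monomial s 1 * dP X S}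

theorem comp_IX {n m : ℕ} (X : Fin m → Fin n → ℝ) (x) (hx : x ∈ IX X) :
    ∀ g k, MvPolynomial.homogeneousComponent k (g * x) ∈ IXk X k := by
  unfold IX at hx
  induction hx using Submodule.span_induction with
  | mem x hx =>
    obtain ⟨S, hS, rfl⟩ := hx
    intro g k
    induction g using MvPolynomial.induction_on' with
    | monomial s c =>
      have hh : (MvPolynomial.monomial s c * dP X S).IsHomogeneous (s.degree + S.card) :=
        (MvPolynomial.isHomogeneous_monomial c rfl).mul (dP_hom X S)
      rw [MvPolynomial.homogeneousComponent_of_mem hh]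
      split_ifs with h
      · have : MvPolynomial.monomial s c * dP X S =
            c • (MvPolynomial.monomial s 1 * dP X S) := by
          rw [← smul_mul_assoc, MvPolynomial.smul_monomial]; simp
        rw [this]
        exact Submodule.smul_mem _ _ (Submodule.subset_span ⟨s, S, hS, h.symm, rfl⟩)
      · exact Submodule.zero_mem _
    | add p q hp hq => rw [add_mul, map_add]; exact Submodule.add_mem _ hp hq
  | zero => simp
  | add x y _ _ hx hy =>
    intro g k
    rw [mul_add, map_add]
    exact Submodule.add_mem _ (hx g k) (hy g k)
  | smul c x _ hx =>
    intro g k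
    rw [smul_eq_mul, ← mul_assoc]
    exact hx _ k

theorem IXk_le {n m : ℕ} (X : Fin m → Fin n → ℝ) (k : ℕ) :
    IXk X k ≤ (IX X).restrictScalars ℝ := by
  refine Submodule.span_le.2 ?_
  rintro _ ⟨s, S, hS, h, rfl⟩
  exact Ideal.mul_mem_left _ _ (Ideal.subset_span ⟨S, hS, rfl⟩)

theorem IXk_le' {n m : ℕ} (X : Fin m → Fin n → ℝ) (l : Fin m → ℝ) (k : ℕ) :
    IXk X k ≤ (JX X l).restrictScalars ℝ ⊔ LL n k := by
  refine Submodule.span_le.2 ?_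
  rintro _ ⟨s, S, hS, h, rfl⟩
  rw [SetLike.mem_coe, Submodule.mem_sup]
  refine ⟨MvPolynomial.monomial s 1 * dL X l S,
    Ideal.mul_mem_left _ _ (Ideal.subset_span ⟨S, hS, rfl⟩),
    MvPolynomial.monomial s 1 * (dP X S - dL X l S), ?_, by ring⟩
  rw [← h]
  exact hom_mul_LL (MvPolynomial.isHomogeneous_monomial _ rfl) (dL_sub X l S)

theorem comp_span {n : ℕ} (B : Set (MvPolynomial (Fin n) ℝ))
    (hB : ∀ b ∈ B, ∃ k, b.IsHomogeneous k) (w) (hw : w ∈ Submodule.span ℝ B) (k : ℕ) :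
    MvPolynomial.homogeneousComponent k w ∈ Submodule.span ℝ B := by
  induction hw using Submodule.span_induction with
  | mem x hx =>
    obtain ⟨j, hj⟩ := hB x hx
    rw [MvPolynomial.homogeneousComponent_of_mem hj]
    split_ifs
    · exact Submodule.subset_span hx
    · exact Submodule.zero_mem _
  | zero => simp
  | add x y _ _ hx hy => rw [map_add]; exact Submodule.add_mem _ hx hy
  | smul c x _ hx => rw [map_smul]; exact Submodule.smul_mem _ _ hx

theorem deform {n m : ℕ} (X : Fin m → Fin n → ℝ) (l : Fin m → ℝ)
    (B : Set (MvPolynomial (Fin n) ℝ))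
    (hB : ∀ b ∈ B, ∃ k, b.IsHomogeneous k)
    (hI : ∀ f, ∃ w ∈ Submodule.span ℝ B, f - w ∈ IX X) (f) :
    f ∈ Submodule.span ℝ B ⊔ (JX X l).restrictScalars ℝ := by
  have key : ∀ k, LL n k ≤ Submodule.span ℝ B ⊔ (JX X l).restrictScalars ℝ := by
    intro k
    induction k with
    | zero =>
      intro p hp
      rw [mem_LL] at hp
      have : p = 0 := by
        ext d
        by_contra h
        exact absurd (hp d (by simpa using h)) (by omega)
      rw [this]; exact Submodule.zero_mem _
    | succ k ih =>
      intro p hp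
      have e : p = MvPolynomial.homogeneousComponent k p +
        (p - MvPolynomial.homogeneousComponent k p) := by ring
      rw [e]
      refine Submodule.add_mem _ ?_ (ih ?_)
      · obtain ⟨w, hw, hi⟩ := hI p
        have h2 := IXk_le' X l k (by simpa only [one_mul] using comp_IX X _ hi 1 k)
        have h3 := comp_span B hB w hw k
        have e2 : MvPolynomial.homogeneousComponent k p =
            MvPolynomial.homogeneousComponent k w +
              MvPolynomial.homogeneousComponent k (p - w) := by
          rw [← map_add]; congr 1; ring
        rw [e2]
        refine Submodule.add_mem _ (Submodule.mem_sup_left h3) ?_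
        exact (sup_le le_sup_right ih) h2
      · rw [mem_LL] at *
        intro d hd
        rw [MvPolynomial.coeff_sub, MvPolynomial.coeff_homogeneousComponent] at hd
        split_ifs at hd with h
        · simp at hd
        · have := hp d (by simpa using hd)
          omega
  refine key (f.totalDegree + 1) ?_
  rw [mem_LL]
  intro d hd
  have := MvPolynomial.le_totalDegree (MvPolynomial.mem_support_iff.2 hd)
  rw [Finsupp.degree_apply]
  exact Nat.lt_succ_of_le this

theorem rad {n m : ℕ} (X : Fin m → Fin n → ℝ)
    (hspan : Submodule.span ℝ (Set.range X) = ⊤)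
    (B : Finset (MvPolynomial (Fin n) ℝ))
    (hB : ∀ b ∈ B, ∃ k, b.IsHomogeneous k)
    (hI : ∀ f, ∃ w ∈ Submodule.span ℝ (B : Set (MvPolynomial (Fin n) ℝ)), f - w ∈ IX X) :
    (IX X).radical =
      Ideal.span (Set.range (MvPolynomial.X : Fin n → MvPolynomial (Fin n) ℝ)) := by
  classical
  have hk : Ideal.span (Set.range (MvPolynomial.X : Fin n → MvPolynomial (Fin n) ℝ)) =
      RingHom.ker (MvPolynomial.constantCoeff (σ := Fin n) (R := ℝ)) := by
    apply le_antisymm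
    · rw [Ideal.span_le]
      rintro _ ⟨i, rfl⟩
      simp [RingHom.mem_ker]
    · intro p hp
      have := (MvPolynomial.mem_pow_idealOfVars_iff' (σ := Fin n) (R := ℝ) 1 p).2 (by
        intro d hd
        have : d = 0 := by
          rw [← Finsupp.degree_eq_zero_iff]; omega
        subst this
        exact hp)
      simpa using this
  apply le_antisymm
  · have hp : (Ideal.span (Set.range
      (MvPolynomial.X : Fin n → MvPolynomial (Fin n) ℝ))).IsPrime := by
      rw [hk]; exact RingHom.ker_isPrime _
    rw [hp.radical_le_iff, hk]
    unfold IX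
    rw [Ideal.span_le]
    rintro _ ⟨S, ⟨H, hH, hn, rfl⟩, rfl⟩
    rw [SetLike.mem_coe, RingHom.mem_ker]
    unfold dP
    rw [map_prod]
    have : ∃ i, X i ∉ H := by
      by_contra! h
      have : (⊤ : Submodule ℝ (Fin n → ℝ)) ≤ H := by
        rw [← hspan, Submodule.span_le]
        rintro _ ⟨i, rfl⟩
        exact h i
      have := Submodule.finrank_mono this
      simp at this
      omega
    obtain ⟨i, hi⟩ := this
    refine Finset.prod_eq_zero (i := i) (by simpa using hi) ?_
    simp [linP]
  · rw [Ideal.span_le]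
    rintro _ ⟨i, rfl⟩
    choose! d hd using hB
    set k := B.sup d + 1 with hk
    refine ⟨k, ?_⟩
    obtain ⟨w, hw, hi⟩ := hI (MvPolynomial.X i ^ k)
    have h1 := IXk_le X k (by simpa only [one_mul] using comp_IX X _ hi 1 k)
    have h2 : MvPolynomial.homogeneousComponent k w = 0 := by
      have : Submodule.span ℝ (B : Set (MvPolynomial (Fin n) ℝ)) ≤
          LinearMap.ker (MvPolynomial.homogeneousComponent (R := ℝ) (σ := Fin n) k) := by
        rw [Submodule.span_le]
        intro b hb
        rw [SetLike.mem_coe, LinearMap.mem_ker, MvPolynomial.homogeneousComponent_of_mem (hd b hb),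
          if_neg]
        have := Finset.le_sup (f := d) hb
        omega
      exact this hw
    have h3 : (MvPolynomial.X i ^ k : MvPolynomial (Fin n) ℝ).IsHomogeneous k := by
      simpa using (MvPolynomial.isHomogeneous_X ℝ i).pow k
    rw [map_sub, h2, MvPolynomial.homogeneousComponent_of_mem h3, if_pos rfl, sub_zero] at h1
    exact h1

theorem eval_linP {n : ℕ} (a p : Fin n → ℝ) : MvPolynomial.eval p (linP a) = ∑ i, a i * p i := by
  simp [linP]

/-- The bases as a set of index sets. -/
def bas {n m : ℕ} (X : Fin m → Fin n → ℝ) : Set (Finset (Fin m)) :=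
  {S : Finset (Fin m) | S.card = n ∧ LinearIndependent ℝ (fun i : S => X i)}

theorem bas_span {n m : ℕ} (X : Fin m → Fin n → ℝ) (S) (hS : S ∈ bas X) :
    Submodule.span ℝ (Set.range (fun i : S => X i)) = ⊤ :=
  hS.2.span_eq_top_of_card_eq_finrank' (by simpa using hS.1)

theorem exists_T {n m : ℕ} (X : Fin m → Fin n → ℝ) (S) (hS : S ∈ bas X) :
    ∃ T : (Fin m → ℝ) →ₗ[ℝ] (Fin n → ℝ), (∀ l, ∀ i ∈ S, ∑ j, X i j * T l j = l i) ∧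
      ∀ l, (∀ i ∈ S, l i = 0) → T l = 0 := by
  let E : (Fin n → ℝ) →ₗ[ℝ] (S → ℝ) := Matrix.mulVecLin (Matrix.of (fun (i : S) j => X i j))
  have hE : ∀ p (i : S), E p i = ∑ j, X i j * p j := fun p i => rfl
  have hinj : Function.Injective E := by
    rw [injective_iff_map_eq_zero]
    intro p hp
    have h1 : Submodule.span ℝ (Set.range (fun i : S => X i)) ≤
        LinearMap.ker (Matrix.mulVecLin (Matrix.of (fun (_ : Unit) j => p j))) := by
      rw [Submodule.span_le]
      rintro _ ⟨i, rfl⟩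
      rw [SetLike.mem_coe, LinearMap.mem_ker]
      ext u
      have := congrFun hp i
      rw [hE] at this
      simpa [Matrix.mulVec, dotProduct, mul_comm] using this
    rw [bas_span X S hS] at h1
    have h2 : p ∈ (⊤ : Submodule ℝ (Fin n → ℝ)) := trivial
    have h3 := congrFun (LinearMap.mem_ker.1 (h1 h2)) ()
    have h4 : ∑ j, p j * p j = 0 := by simpa [Matrix.mulVec, dotProduct] using h3
    rw [Finset.sum_eq_zero_iff_of_nonneg (fun i _ => mul_self_nonneg _)] at h4
    ext j
    simpa using h4 j (Finset.mem_univ j)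
  let e := LinearEquiv.ofInjectiveOfFinrankEq E hinj (by simpa using hS.1.symm)
  have he : ∀ p, e p = E p := fun p => rfl
  refine ⟨e.symm.toLinearMap ∘ₗ LinearMap.funLeft ℝ ℝ (fun i : S => (i : Fin m)), ?_, ?_⟩
  · intro l i hi
    have := hE (e.symm (LinearMap.funLeft ℝ ℝ (fun i : S => (i : Fin m)) l)) ⟨i, hi⟩
    rw [← he, LinearEquiv.apply_symm_apply] at this
    exact this.symm
  · intro l hl
    have : LinearMap.funLeft ℝ ℝ (fun i : S => (i : Fin m)) l = 0 := by
      ext i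
      exact hl i i.2
    simp [this]

theorem exists_pts {n m : ℕ} (X : Fin m → Fin n → ℝ) :
    ∃ (l : Fin m → ℝ) (p : bas X → (Fin n → ℝ)), Function.Injective p ∧
      ∀ S : bas X, ∀ i ∈ S.1, ∑ j, X i j * p S j = l i := by
  classical
  have := fun S : bas X => exists_T X S.1 S.2
  choose T hT hT0 using this
  let ι := {q : bas X × Fin m // q.2 ∉ q.1.1}
  let φ : ι → Module.Dual ℝ (Fin m → ℝ) := fun q =>

      (LinearMap.proj () ∘ₗ Matrix.mulVecLin (Matrix.of (fun (_ : Unit) j => X q.1.2 j)) ∘ₗ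
        T q.1.1) - LinearMap.proj q.1.2
  have hφ : ∀ q l, φ q l = ∑ j, X q.1.2 j * T q.1.1 l j - l q.1.2 := fun q l => rfl
  obtain ⟨l, hl⟩ := Module.Dual.exists_forall_ne_zero_of_forall_exists φ (by
    intro q
    refine ⟨Pi.single q.1.2 1, ?_⟩
    rw [hφ, hT0 q.1.1 _ (by
      intro i hi
      rw [Pi.single_eq_of_ne]
      rintro rfl
      exact q.2 hi)]
    simp)
  refine ⟨l, fun S => T S l, ?_, fun S i hi => hT S l i hi⟩
  intro S S' h
  by_contra hne
  have : ∃ i ∈ S'.1, i ∉ S.1 := by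
    by_contra! h2
    have : S'.1 = S.1 := Finset.eq_of_subset_of_card_le h2 (by rw [S.2.1, S'.2.1])
    exact hne (Subtype.ext this.symm)
  obtain ⟨i, hi, hi'⟩ := this
  apply hl ⟨(S, i), hi'⟩
  rw [hφ]
  have h3 := hT S' l i hi
  simp only at h ⊢
  rw [h, h3, sub_self]

theorem lower {n m : ℕ} (X : Fin m → Fin n → ℝ)
    (κ : Type*) [Fintype κ] (v : κ → MvPolynomial (Fin n) ℝ)
    (hB : ∀ i, ∃ k, (v i).IsHomogeneous k)
    (hI : ∀ f, ∃ w ∈ Submodule.span ℝ (Set.range v), f - w ∈ IX X) :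
    (bas X).ncard ≤ Fintype.card κ := by
  classical
  obtain ⟨l, p, hp, hpl⟩ := exists_pts X
  let ev : MvPolynomial (Fin n) ℝ →ₗ[ℝ] (bas X → ℝ) :=
    LinearMap.pi (fun S => (MvPolynomial.aeval (p S)).toLinearMap)
  have hev : ∀ f S, ev f S = MvPolynomial.eval (p S) f := fun f S => by
    simp [ev, MvPolynomial.aeval_eq_eval]
  have hJ : ∀ f ∈ JX X l, ev f = 0 := by
    intro f hf
    ext S
    rw [hev]
    have : JX X l ≤ RingHom.ker (MvPolynomial.eval (p S)) := by
      unfold JX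
      rw [Ideal.span_le]
      rintro _ ⟨Y, ⟨H, hH, hn, rfl⟩, rfl⟩
      rw [SetLike.mem_coe, RingHom.mem_ker]
      unfold dL
      rw [map_prod]
      have : ∃ i ∈ S.1, X i ∉ H := by
        by_contra! h
        have : (⊤ : Submodule ℝ (Fin n → ℝ)) ≤ H := by
          rw [← bas_span X S.1 S.2, Submodule.span_le]
          rintro _ ⟨i, rfl⟩
          exact h i i.2
        have := Submodule.finrank_mono this
        simp at this
        omega
      obtain ⟨i, hi, hiH⟩ := this
      refine Finset.prod_eq_zero (i := i) (by simpa using hiH) ?_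
      rw [map_sub, eval_linP, hpl S i hi]
      simp
    exact this hf
  have hsurj : Function.Surjective ev := by
    -- separate points
    have hs : ∀ S : bas X, ∃ f, ev f = Pi.single S 1 := by
      intro S
      have : ∀ S' : bas X, ∃ f : MvPolynomial (Fin n) ℝ, MvPolynomial.eval (p S) f = 1 ∧
          (S' ≠ S → MvPolynomial.eval (p S') f = 0) := by
        intro S'
        by_cases h : S' = S
        · exact ⟨1, by simp, fun h' => absurd h h'⟩
        · have : p S' ≠ p S := fun h' => h (hp h')
          obtain ⟨j, hj⟩ := Function.ne_iff.1 this
          have hj' : p S j - p S' j ≠ 0 := sub_ne_zero.2 hj.symm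
          refine ⟨MvPolynomial.C (p S j - p S' j)⁻¹ *
            (MvPolynomial.X j - MvPolynomial.C (p S' j)), ?_, fun _ => ?_⟩
          · simp [hj']
          · simp
      choose f hf hf' using this
      refine ⟨∏ S', f S', ?_⟩
      ext S'
      rw [hev, map_prod]
      by_cases h : S' = S
      · subst h
        simp [hf]
      · rw [Pi.single_eq_of_ne h]
        exact Finset.prod_eq_zero (Finset.mem_univ S') (hf' S' h)
    choose g hg using hs
    intro y
    refine ⟨∑ S, y S • g S, ?_⟩
    rw [map_sum]
    simp_rw [map_smul, hg]
    ext S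
    simp [Finset.sum_apply, Pi.single_apply]
  have htop : Submodule.span ℝ (Set.range (ev ∘ v)) = ⊤ := by
    rw [eq_top_iff]
    intro y _
    obtain ⟨f, rfl⟩ := hsurj y
    have := deform X l (Set.range v) (by rintro _ ⟨i, rfl⟩; exact hB i) hI f
    rw [Submodule.mem_sup] at this
    obtain ⟨w, hw, j, hj, rfl⟩ := this
    rw [map_add, hJ j hj, add_zero, Set.range_comp, ← Submodule.map_span]
    exact ⟨w, hw, rfl⟩
  have h1 := finrank_range_le_card (R := ℝ) (ev ∘ v)
  rw [Set.finrank, htop, finrank_top, Module.finrank_fintype_fun_eq_card] at h1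
  rw [← Nat.card_coe_set_eq, Nat.card_eq_fintype_card]
  exact h1

theorem cocircuit_main {n m : ℕ} (X : Fin m → Fin n → ℝ)
    (hspan : Submodule.span ℝ (Set.range X) = ⊤) :
    (IX X).radical = Ideal.span (Set.range (MvPolynomial.X : Fin n → MvPolynomial (Fin n) ℝ)) ∧
    Module.finrank ℝ (MvPolynomial (Fin n) ℝ ⧸ IX X) = (bas X).ncard := by
  classical
  obtain ⟨B, h1, h2, h3'⟩ := upper X Finset.univ ⊥ (by simpa using hspan)
  have hle : relI X Finset.univ ⊥ ≤ IX X := by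
    refine Ideal.span_le.2 ?_
    rintro x (⟨u, hu, rfl⟩ | ⟨H, hH, rfl⟩)
    · rw [(Submodule.mem_bot ℝ).1 hu, linP_zero]; exact Ideal.zero_mem _
    · refine Ideal.subset_span ⟨_, ⟨H, ?_, hH.2.2, rfl⟩, ?_⟩
      · apply le_antisymm
        · refine hH.2.1.trans (sup_le bot_le (Submodule.span_mono ?_))
          rintro _ ⟨i, hi, rfl⟩
          exact ⟨⟨i, rfl⟩, hi.2⟩
        · rw [Submodule.span_le]
          exact Set.inter_subset_right
      · congr
  have h3 : ∀ f, ∃ w ∈ Submodule.span ℝ (B : Set (MvPolynomial (Fin n) ℝ)), f - w ∈ IX X := by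
    intro f
    obtain ⟨w, hw, h⟩ := h3' f
    exact ⟨w, hw, hle h⟩
  refine ⟨rad X hspan B h1 h3, ?_⟩
  have hcard : (relB X Finset.univ ⊥).card ≤ (bas X).ncard := by
    rw [← Set.ncard_coe_finset]
    apply Set.ncard_le_ncard _ (Set.toFinite _)
    intro b hb
    simp only [relB, Finset.coe_filter, Finset.mem_powerset, Set.mem_ofPred_eq, bot_sup_eq,
      finrank_bot, add_zero] at hb
    refine ⟨hb.2.1, linearIndependent_of_top_le_span_of_card_eq_finrank ?_ ?_⟩
    · rw [← hb.2.2]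
      apply Submodule.span_mono
      rintro _ ⟨i, hi, rfl⟩
      exact ⟨⟨i, hi⟩, rfl⟩
    · simpa using hb.2.1
  let q : MvPolynomial (Fin n) ℝ →ₗ[ℝ] (MvPolynomial (Fin n) ℝ ⧸ IX X) :=
    (Ideal.Quotient.mkₐ ℝ (IX X)).toLinearMap
  have hq0 : ∀ f, q f = 0 ↔ f ∈ IX X := fun f => Ideal.Quotient.eq_zero_iff_mem
  have hqs : Function.Surjective q := Ideal.Quotient.mk_surjective
  obtain ⟨κ, a, ha, hsp, hli⟩ := exists_linearIndependent' (K := ℝ)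
    (fun b : B => q (b : MvPolynomial (Fin n) ℝ))
  have : Finite κ := Finite.of_injective a ha
  have := Fintype.ofFinite κ
  have htop : Submodule.span ℝ (Set.range (fun b : B => q (b : MvPolynomial (Fin n) ℝ))) = ⊤ := by
    rw [eq_top_iff]
    intro y _
    obtain ⟨f, rfl⟩ := hqs y
    obtain ⟨w, hw, h⟩ := h3 f
    have : q f = q w := by
      rw [← sub_eq_zero, ← map_sub, hq0]; exact h
    rw [this]
    have h5 : q w ∈ (Submodule.span ℝ (B : Set (MvPolynomial (Fin n) ℝ))).map q := ⟨w, hw, rfl⟩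
    rw [Submodule.map_span] at h5
    refine Submodule.span_mono ?_ h5
    rintro _ ⟨b, hb, rfl⟩
    exact ⟨⟨b, hb⟩, rfl⟩
  rw [htop] at hsp
  have hfin : Module.finrank ℝ (MvPolynomial (Fin n) ℝ ⧸ IX X) = Fintype.card κ :=
    Module.finrank_eq_card_basis (Module.Basis.mk hli hsp.ge)
  rw [hfin]
  apply le_antisymm
  · have h6 := Fintype.card_le_of_injective a ha
    rw [Fintype.card_coe] at h6
    exact h6.trans (h2.trans hcard)
  · refine lower X κ (fun i => ((a i : B) : MvPolynomial (Fin n) ℝ)) (fun i => h1 _ (a i).2) ?_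
    intro f
    have h7 : q f ∈ (⊤ : Submodule ℝ (MvPolynomial (Fin n) ℝ ⧸ IX X)) := trivial
    rw [← hsp] at h7
    have e : Set.range ((fun b : B => q (b : MvPolynomial (Fin n) ℝ)) ∘ a) =
        q '' (Set.range (fun i => ((a i : B) : MvPolynomial (Fin n) ℝ))) := by
      rw [← Set.range_comp]; rfl
    rw [e, ← Submodule.map_span] at h7
    obtain ⟨w, hw, h8⟩ := h7
    refine ⟨w, hw, ?_⟩
    rw [← hq0, map_sub, h8, sub_self]

theorem stmt10 {n m : ℕ} (X : Fin m → Fin n → ℝ)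
    (hX0 : ∀ i, X i ≠ 0)
    (hspan : Submodule.span ℝ (Set.range X) = ⊤) :
    (IX X).radical = Ideal.span (Set.range (MvPolynomial.X : Fin n → MvPolynomial (Fin n) ℝ)) ∧
    Module.finrank ℝ (MvPolynomial (Fin n) ℝ ⧸ IX X) =
      Set.ncard {S : Finset (Fin m) |
        S.card = n ∧ LinearIndependent ℝ (fun i : S => X i)} := by
  exact cocircuit_main X hspan
end
end
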